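/- If (a, b) ∈ O × O satisfies η(conj a) * a + η(conj b) + b = 0 and (a,b) ≠ (0,0), then b ≠ 0 and the pair (−(a * inv b), inv b) again satisfies η(conj(−(a * inv b))) * (−(a * inv b)) + η(conj(inv b)) + inv b = 0. (This is the well-definedness of the permutation τ(a,b) = (−a·b⁻¹, b⁻¹) on the nonzero elements of the root group U, asserted in Section 5.1 of the paper.) -/

import Mathlib

noncomputable section

open Quaternion

/-- Multiplication of the Cayley–Dickson double `O = D × D` of the quaternion algebra `D`. -/
def omul {k : Type*} [Field k] {c₁ c₂ : k} (β : k)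
    (x y : ℍ[k,c₁,c₂] × ℍ[k,c₁,c₂]) : ℍ[k,c₁,c₂] × ℍ[k,c₁,c₂] :=
  (x.1 * y.1 - β • (y.2 * star x.2), y.1 * x.2 + star x.1 * y.2)

/-- Conjugation of the Cayley–Dickson double. -/
def oconj {k : Type*} [Field k] {c₁ c₂ : k}
    (x : ℍ[k,c₁,c₂] × ℍ[k,c₁,c₂]) : ℍ[k,c₁,c₂] × ℍ[k,c₁,c₂] :=
  (star x.1, -x.2)

/-- The inverse `inv x = N(x)⁻¹ • conj x` in the Cayley–Dickson double, where
`N(x₁,x₂) = n(x₁) + β·n(x₂)` and `n` is the quaternion norm. -/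
def oinv {k : Type*} [Field k] {c₁ c₂ : k} (β : k) (n : ℍ[k,c₁,c₂] → k)
    (x : ℍ[k,c₁,c₂] × ℍ[k,c₁,c₂]) : ℍ[k,c₁,c₂] × ℍ[k,c₁,c₂] :=
  (n x.1 + β * n x.2)⁻¹ • oconj x

/-- Explicit quaternion norm. -/
def qn {k : Type*} [Field k] {c₁ c₂ : k} (a : ℍ[k,c₁,c₂]) : k :=
  a.re ^ 2 - c₁ * a.imI ^ 2 - c₂ * a.imJ ^ 2 + c₁ * c₂ * a.imK ^ 2

/-- Explicit octonion norm. -/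
def oN {k : Type*} [Field k] {c₁ c₂ : k} (β : k) (x : ℍ[k,c₁,c₂] × ℍ[k,c₁,c₂]) : k :=
  qn x.1 + β * qn x.2

/-- Octonion bilinear form. -/
def oB {k : Type*} [Field k] {c₁ c₂ : k} (β : k) (x y : ℍ[k,c₁,c₂] × ℍ[k,c₁,c₂]) : k :=
  oN β (x + y) - oN β x - oN β y

section
variable {k : Type*} [Field k] {c₁ c₂ : k} (β : k)

theorem qn_eq (n : ℍ[k,c₁,c₂] → k) (a : ℍ[k,c₁,c₂]) (h : a * star a = n a • 1) : n a = qn a := by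
  have := congrArg QuaternionAlgebra.re h
  simp at this
  rw [← this, qn]; ring

theorem oconj_omul (x y : ℍ[k,c₁,c₂] × ℍ[k,c₁,c₂]) :
    oconj (omul β x y) = omul β (oconj y) (oconj x) := by
  ext <;> simp [oconj, omul] <;> ring

theorem oconj_oconj (x : ℍ[k,c₁,c₂] × ℍ[k,c₁,c₂]) : oconj (oconj x) = x := by
  simp [oconj]

theorem left_alt (x y : ℍ[k,c₁,c₂] × ℍ[k,c₁,c₂]) :
    omul β (oconj x) (omul β x y) = oN β x • y := by
  ext <;> simp [oconj, omul, oN, qn] <;> ring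

theorem right_alt (x y : ℍ[k,c₁,c₂] × ℍ[k,c₁,c₂]) :
    omul β (omul β x (oconj y)) y = oN β y • x := by
  ext <;> simp [oconj, omul, oN, qn] <;> ring

theorem oN_mul (x y : ℍ[k,c₁,c₂] × ℍ[k,c₁,c₂]) :
    oN β (omul β x y) = oN β x * oN β y := by
  simp [omul, oN, qn]; ring

set_option maxHeartbeats 4000000 in
theorem wb (w b : ℍ[k,c₁,c₂] × ℍ[k,c₁,c₂]) :
    omul β (omul β (oconj b) w) (oconj b) + oN β b • oconj w = oB β w b • oconj b := by
  ext <;> simp [oconj, omul, oN, qn, oB] <;> ring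

set_option maxHeartbeats 8000000 in
theorem moufang (x u a : ℍ[k,c₁,c₂] × ℍ[k,c₁,c₂]) :
    omul β (omul β x u) (omul β a x) = omul β (omul β x (omul β u a)) x := by
  ext <;> simp [omul] <;> ring

theorem omul_add (x y z : ℍ[k,c₁,c₂] × ℍ[k,c₁,c₂]) :
    omul β x (y + z) = omul β x y + omul β x z := by
  ext <;> simp [omul] <;> ring

theorem add_omul (x y z : ℍ[k,c₁,c₂] × ℍ[k,c₁,c₂]) :
    omul β (x + y) z = omul β x z + omul β y z := by
  ext <;> simp [omul] <;> ring

theorem smul_omul (r : k) (x y : ℍ[k,c₁,c₂] × ℍ[k,c₁,c₂]) :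
    omul β (r • x) y = r • omul β x y := by
  ext <;> simp [omul] <;> ring

theorem omul_smul (r : k) (x y : ℍ[k,c₁,c₂] × ℍ[k,c₁,c₂]) :
    omul β x (r • y) = r • omul β x y := by
  ext <;> simp [omul] <;> ring

theorem neg_omul_neg (x y : ℍ[k,c₁,c₂] × ℍ[k,c₁,c₂]) :
    omul β (-x) (-y) = omul β x y := by
  simp [omul]

theorem oN_neg (x : ℍ[k,c₁,c₂] × ℍ[k,c₁,c₂]) : oN β (-x) = oN β x := by
  simp [oN, qn]

theorem key (u a b c : ℍ[k,c₁,c₂] × ℍ[k,c₁,c₂]) (h : omul β u a + c + b = 0) :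
    omul β (omul β (oconj c) u) (omul β a (oconj b)) + oN β b • oconj c
      + oN β c • oconj b = 0 := by
  set w := omul β u a with hw
  have hc : c = -(w + b) := by
    rw [eq_neg_iff_add_eq_zero, ← h]; abel
  have hcc : oconj c = (-1 : k) • (oconj w + oconj b) := by
    rw [hc]; ext <;> simp [oconj] <;> ring
  have hNc : oN β c = oN β w + oN β b + oB β w b := by
    rw [hc, oN_neg, oB]; ring
  have h1 : omul β (omul β (oconj w) u) (omul β a (oconj b)) = oN β w • oconj b := by
    rw [hw, oconj_omul, right_alt, smul_omul, left_alt, oN_mul, smul_smul]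
  have h2 := wb β w b
  have h3 := moufang β (oconj b) u a
  rw [← hw] at h3
  rw [hcc, hNc, smul_omul, add_omul, smul_omul, add_omul, h1, h3, eq_sub_of_add_eq h2]
  module

end

/-- well-definedness of the permutation `τ(a,b) = (-a·b⁻¹, b⁻¹)` on the
nonzero elements of the root group `U`. -/
theorem τ_well_defined {k : Type*} [Field k] (c₁ c₂ : k) (β : k) (hβ : β ≠ 0)
    (n : ℍ[k,c₁,c₂] → k)
    (hn : ∀ a : ℍ[k,c₁,c₂], a * star a = n a • 1 ∧ star a * a = n a • 1)
    (haniso : ∀ x : ℍ[k,c₁,c₂] × ℍ[k,c₁,c₂], n x.1 + β * n x.2 = 0 → x = 0)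
    (η : ℍ[k,c₁,c₂] × ℍ[k,c₁,c₂] → ℍ[k,c₁,c₂] × ℍ[k,c₁,c₂])
    (hbij : Function.Bijective η)
    (hadd : ∀ x y, η (x + y) = η x + η y)
    (hmul : ∀ x y, η (omul β x y) = omul β (η x) (η y))
    (hone : η ((1 : ℍ[k,c₁,c₂]), (0 : ℍ[k,c₁,c₂])) = (1, 0))
    (hinvol : ∀ x, η (η x) = x)
    (hconj : ∀ x, η (oconj x) = oconj (η x)) :
    ∀ a b : ℍ[k,c₁,c₂] × ℍ[k,c₁,c₂],
      omul β (η (oconj a)) a + η (oconj b) + b = 0 →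
      (a, b) ≠ (0, 0) →
      b ≠ 0 ∧
      omul β (η (oconj (-(omul β a (oinv β n b))))) (-(omul β a (oinv β n b)))
        + η (oconj (oinv β n b)) + oinv β n b = 0 := by
  have hN : ∀ x : ℍ[k,c₁,c₂] × ℍ[k,c₁,c₂], n x.1 + β * n x.2 = oN β x := fun x => by
    rw [qn_eq n _ (hn x.1).1, qn_eq n _ (hn x.2).1, oN]
  have hN0 : ∀ x : ℍ[k,c₁,c₂] × ℍ[k,c₁,c₂], oN β x = 0 → x = 0 := fun x hx =>
    haniso x (by rw [hN, hx])
  have hinv : ∀ x, oinv β n x = (oN β x)⁻¹ • oconj x := fun x => by rw [oinv, hN]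
  have hη0 : η 0 = 0 := by simpa using hadd 0 0
  have hηneg : ∀ x, η (-x) = -η x := fun x => by
    rw [eq_neg_iff_add_eq_zero, ← hadd, neg_add_cancel, hη0]
  have hcneg : ∀ x : ℍ[k,c₁,c₂] × ℍ[k,c₁,c₂], oconj (-x) = -oconj x := fun x => by
    ext <;> simp [oconj]
  have hc0 : oconj (0 : ℍ[k,c₁,c₂] × ℍ[k,c₁,c₂]) = 0 := by simp [oconj]
  have hs0 : ∀ x, η (oconj x) = 0 → x = 0 := fun x hx => by
    have h1 : oconj x = 0 := by rw [← hinvol (oconj x), hx, hη0]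
    rw [← oconj_oconj x, h1, hc0]
  intro a b h hab
  have hb : b ≠ 0 := by
    rintro rfl
    rw [hc0, hη0, add_zero, add_zero] at h
    have h1 : oN β (η (oconj a)) * oN β a = 0 := by
      rw [← oN_mul, h]; simp [oN, qn]
    apply hab
    rcases mul_eq_zero.1 h1 with h2 | h2
    · rw [hs0 a (hN0 _ h2)]
    · rw [hN0 _ h2]
  refine ⟨hb, ?_⟩
  have hNb : oN β b ≠ 0 := fun h => hb (hN0 b h)
  have hNc : oN β (η (oconj b)) ≠ 0 := fun h => hb (hs0 b (hN0 _ h))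
  have hk := key β _ _ _ _ h
  have hbb : omul β (oinv β n b) b = ((1 : ℍ[k,c₁,c₂]), (0 : ℍ[k,c₁,c₂])) := by
    have h1 := left_alt β b (1, 0)
    have h2 : omul β b (1, 0) = b := by simp [omul]
    rw [h2] at h1
    rw [hinv, smul_omul, h1, smul_smul, inv_mul_cancel₀ hNb, one_smul]
  have hsinv : η (oconj (oinv β n b)) = (oN β (η (oconj b)))⁻¹ • oconj (η (oconj b)) := by
    have h1 := congrArg (fun x => η (oconj x)) hbb
    have h2 : oconj ((1 : ℍ[k,c₁,c₂]), (0 : ℍ[k,c₁,c₂])) = (1, 0) := by simp [oconj]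
    simp only [oconj_omul, hmul, h2, hone] at h1
    have h3 := left_alt β (η (oconj b)) (η (oconj (oinv β n b)))
    rw [h1] at h3
    have h4 : ∀ x : ℍ[k,c₁,c₂] × ℍ[k,c₁,c₂], omul β x (1, 0) = x := fun x => by simp [omul]
    rw [h4] at h3
    rw [h3, smul_smul, inv_mul_cancel₀ hNc, one_smul]
  rw [hcneg, hηneg, neg_omul_neg, oconj_omul, hmul, hsinv, hinv, smul_omul, omul_smul, smul_omul,
    omul_smul]
  generalize η (oconj b) = c at *
  have h5 := congrArg (fun x => ((oN β c)⁻¹ * (oN β b)⁻¹) • x) hk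
  simp only [smul_add, smul_zero, smul_smul] at h5
  rw [mul_assoc, inv_mul_cancel₀ hNb, mul_one, mul_right_comm, inv_mul_cancel₀ hNc, one_mul] at h5
  rw [← h5, smul_smul, mul_comm]
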